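/- Let R be the Laurent polynomial ring in two variables over F₂, with x and y the monomials of exponents (1,0) and (0,1). For all odd positive integers n and m, the quotient ring R/(x^n − 1, y^m − 1) is reduced, i.e., has no nonzero nilpotent elements. -/

import Mathlib

open Matrix

noncomputable section

set_option synthInstance.maxHeartbeats 1000000
set_option maxHeartbeats 1000000

/-- `R = F₂[x^{±1}, y^{±1}]`, the Laurent polynomial ring in two variables over the field
with two elements, realized as the monoid algebra of the additive group `ℤ × ℤ` over `ZMod 2`. -/
abbrev LaurentF2 : Type := AddMonoidAlgebra (ZMod 2) (ℤ × ℤ)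

/-- The antipode automorphism `bar`, induced by the group automorphism `(a,b) ↦ (-a,-b)`. -/
def barR : LaurentF2 ≃ₐ[ZMod 2] LaurentF2 :=
  AddMonoidAlgebra.domCongr (ZMod 2) (ZMod 2) (AddEquiv.neg (ℤ × ℤ))

/-- The automorphism `σ`, induced by the group automorphism `(a,b) ↦ (b,a)`. -/
def sigR : LaurentF2 ≃ₐ[ZMod 2] LaurentF2 :=
  AddMonoidAlgebra.domCongr (ZMod 2) (ZMod 2) (AddEquiv.prodComm : ℤ × ℤ ≃+ ℤ × ℤ)

/-- The automorphism `ρ`, induced by the group automorphism `(a,b) ↦ (-b,-a)`. -/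
def rhoR : LaurentF2 ≃ₐ[ZMod 2] LaurentF2 :=
  AddMonoidAlgebra.domCongr (ZMod 2) (ZMod 2)
    ((AddEquiv.prodComm : ℤ × ℤ ≃+ ℤ × ℤ).trans (AddEquiv.neg (ℤ × ℤ)))

/-- The monomial `x`, of exponent `(1, 0)`. -/
def xGen : LaurentF2 := AddMonoidAlgebra.single ((1 : ℤ), (0 : ℤ)) 1

/-- The monomial `y`, of exponent `(0, 1)`. -/
def yGen : LaurentF2 := AddMonoidAlgebra.single ((0 : ℤ), (1 : ℤ)) 1

/-- The ideal `(x^n - 1, y^m - 1)` encoding periodic boundary conditions on an `n × m` torus. -/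
def torusIdeal (n m : ℕ) : Ideal LaurentF2 := Ideal.span {xGen ^ n - 1, yGen ^ m - 1}

/-- The quotient ring `R_{n,m} = R/(x^n - 1, y^m - 1)`. -/
abbrev RTorus (n m : ℕ) : Type := LaurentF2 ⧸ torusIdeal n m

/-- The quotient map `π : R → R_{n,m}`. -/
def torusQuot (n m : ℕ) : LaurentF2 →+* RTorus n m := Ideal.Quotient.mk _

/-- If a surjection `f` from a monoid algebra over `ZMod p` sends every monomial to an `N`-th root
of unity, with `N` prime to `p`, then its target is reduced: some power of the Frobenius of the
target is the identity. -/
theorem isReduced_of_surjective_of_pow_eq_one {p : ℕ} [Fact p.Prime] {G A : Type*} [AddMonoid G]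
    [CommRing A] [CharP A p] (f : AddMonoidAlgebra (ZMod p) G →+* A)
    (hf : Function.Surjective f) {N : ℕ} (hN : p.Coprime N)
    (h : ∀ g, f (AddMonoidAlgebra.single g 1) ^ N = 1) : IsReduced A := by
  have hp : p.Prime := Fact.out
  have hN0 : N ≠ 0 := by
    rintro rfl
    exact hp.one_lt.ne' ((Nat.coprime_zero_right p).1 hN)
  have hk : N.totient ≠ 0 := (Nat.totient_pos.2 hN0.bot_lt).ne'
  have hid : (iterateFrobenius A p N.totient).comp f = f := by
    refine AddMonoidAlgebra.ringHom_ext' (Subsingleton.elim _ _) (MonoidHom.ext fun g => ?_)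
    have hdvd : N ∣ p ^ N.totient - 1 :=
      (Nat.modEq_iff_dvd' (Nat.one_le_pow _ _ hp.pos)).1 (Nat.ModEq.pow_totient hN).symm
    obtain ⟨c, hc⟩ := hdvd
    have hpow : p ^ N.totient = N * c + 1 := by
      have := Nat.one_le_pow N.totient p hp.pos
      lia
    change f (AddMonoidAlgebra.single g.toAdd 1) ^ p ^ N.totient
      = f (AddMonoidAlgebra.single g.toAdd 1)
    rw [hpow, pow_succ, pow_mul, h, one_pow, one_mul]
  refine (isReduced_iff_pow_one_lt _ (Nat.one_lt_pow hk hp.one_lt)).2 fun a ha => ?_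
  obtain ⟨r, rfl⟩ := hf a
  rw [← RingHom.congr_fun hid r]
  exact ha

/-- A homomorphism from `ℤ × ℤ` to a commutative monoid takes values in the `n * m`-th roots of
unity as soon as the two generators are sent to `n`-th and `m`-th roots of unity. -/
theorem MonoidHom.pow_mul_eq_one_of_int_prod {M : Type*} [CommMonoid M]
    (v : Multiplicative (ℤ × ℤ) →* M) {n m : ℕ} (hx : v (.ofAdd (1, 0)) ^ n = 1)
    (hy : v (.ofAdd (0, 1)) ^ m = 1) (g : ℤ × ℤ) : v (.ofAdd g) ^ (n * m) = 1 := by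
  have hux : v.toHomUnits (.ofAdd (1, 0)) ^ n = 1 := Units.ext hx
  have huy : v.toHomUnits (.ofAdd (0, 1)) ^ m = 1 := Units.ext hy
  have hg : Multiplicative.ofAdd g = .ofAdd (1, 0) ^ g.1 * .ofAdd (0, 1) ^ g.2 := by
    rw [← ofAdd_zsmul, ← ofAdd_zsmul, ← ofAdd_add]
    simp
  have hu : v.toHomUnits (.ofAdd g) ^ (n * m) = 1 := by
    rw [hg, map_mul, map_zpow, map_zpow, mul_pow, ← zpow_natCast, ← zpow_natCast,
      zpow_comm, zpow_comm _ g.2, zpow_natCast, zpow_natCast, pow_mul, hux, mul_comm n m,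
      pow_mul, huy]
    simp
  exact congrArg Units.val hu

/-- In the torus quotient, every monomial is an `n * m`-th root of unity. -/
theorem torusQuot_single_pow (n m : ℕ) (g : ℤ × ℤ) :
    torusQuot n m (AddMonoidAlgebra.single g 1) ^ (n * m) = 1 := by
  have hx : torusQuot n m xGen ^ n = 1 := by
    rw [← map_pow, ← sub_eq_zero, ← map_one (torusQuot n m), ← map_sub]
    exact Ideal.Quotient.eq_zero_iff_mem.2 (Ideal.subset_span (Set.mem_insert _ _))
  have hy : torusQuot n m yGen ^ m = 1 := by
    rw [← map_pow, ← sub_eq_zero, ← map_one (torusQuot n m), ← map_sub]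
    exact Ideal.Quotient.eq_zero_iff_mem.2 (Ideal.subset_span (Set.mem_insert_of_mem _ rfl))
  exact MonoidHom.pow_mul_eq_one_of_int_prod
    ((torusQuot n m : LaurentF2 →* RTorus n m).comp (AddMonoidAlgebra.of (ZMod 2) (ℤ × ℤ))) hx hy g

/-- For odd positive `n`, `m`, the torus quotient `R/(x^n - 1, y^m - 1)` is reduced. -/
theorem torus_quotient_isReduced
    (n m : ℕ) (hn : Odd n) (hm : Odd m) (hn' : 0 < n) (hm' : 0 < m) :
    IsReduced (RTorus n m) := by
  rcases subsingleton_or_nontrivial (RTorus n m) with _ | _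
  · infer_instance
  have : CharP (RTorus n m) 2 :=
    charP_of_injective_algebraMap (algebraMap (ZMod 2) (RTorus n m)).injective 2
  exact isReduced_of_surjective_of_pow_eq_one (torusQuot n m) Ideal.Quotient.mk_surjective
    (Nat.coprime_two_left.2 (hn.mul hm)) (torusQuot_single_pow n m)
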